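/- arXiv:1607.00271 — 3 statements merged into one kernel-verified Lean document; each statement's English description precedes it below -/
import Mathlib

section
/- Let A be an associative 𝕂-algebra, let i, j ≥ 1 be integers, and let w^r (−i ≤ r ≤ i−1) and m^s (−j ≤ s ≤ j−1) be elements of A such that w^r m^s = q² m^s w^r if (r,s) = (−i, j−1), w^r m^s = q^{−2} m^s w^r if (r,s) = (i−1, −j), and w^r m^s = m^s w^r for all other pairs (r,s). Set E = Σ_{r=−i}^{i−1} w^r, F = Σ_{s=−j}^{j−1} m^s, K = −q w^{i−1} m^{−j}, and K' = −q m^{j−1} w^{−i}. Then EF − FE = (q − q^{−1})(K − K'). (This is the verification of the relation [E_i, F_i] = (q−q^{−1})(K_i − K_i') for the images of the quantum group generators under the cluster embedding ι.) -/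
noncomputable section

/-- The ground field `𝕂 = ℂ(q)`, the field of rational functions over `ℂ`. -/
abbrev Kq : Type := RatFunc ℂ

/-- The formal variable `q ∈ ℂ(q)`. -/
def qq : Kq := RatFunc.X

/-- Let `A` be an associative `𝕂`-algebra, `i, j ≥ 1`, and let
`w^r` (`−i ≤ r ≤ i−1`) and `m^s` (`−j ≤ s ≤ j−1`) be elements of `A` such that
`w^r m^s = q² m^s w^r` if `(r,s) = (−i, j−1)`, `w^r m^s = q^{−2} m^s w^r` if
`(r,s) = (i−1, −j)`, and `w^r m^s = m^s w^r` for all other pairs.  Set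
`E = Σ w^r`, `F = Σ m^s`, `K = −q w^{i−1} m^{−j}`, `K' = −q m^{j−1} w^{−i}`.
Then `EF − FE = (q − q^{−1})(K − K')`. -/
theorem statement5 {A : Type*} [Ring A] [Algebra Kq A] (i j : ℤ)
    (hi : 1 ≤ i) (hj : 1 ≤ j) (w m : ℤ → A)
    (h1 : w (-i) * m (j - 1) = (qq ^ (2 : ℤ)) • (m (j - 1) * w (-i)))
    (h2 : w (i - 1) * m (-j) = (qq ^ (-2 : ℤ)) • (m (-j) * w (i - 1)))
    (h3 : ∀ r s : ℤ, -i ≤ r → r ≤ i - 1 → -j ≤ s → s ≤ j - 1 →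
      (r, s) ≠ (-i, j - 1) → (r, s) ≠ (i - 1, -j) → w r * m s = m s * w r) :
    (∑ r ∈ Finset.Icc (-i) (i - 1), w r) * (∑ s ∈ Finset.Icc (-j) (j - 1), m s)
        - (∑ s ∈ Finset.Icc (-j) (j - 1), m s) * (∑ r ∈ Finset.Icc (-i) (i - 1), w r)
      = (qq - qq⁻¹) • (-(qq • (w (i - 1) * m (-j))) - -(qq • (m (j - 1) * w (-i)))) := by
  have hq : qq ≠ 0 := RatFunc.X_ne_zero
  have hP : w (-i) * m (j - 1) - m (j - 1) * w (-i)
      = (qq ^ 2 - 1) • (m (j - 1) * w (-i)) := by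
    rw [h1, sub_smul, one_smul, zpow_ofNat]
  have hQ : w (i - 1) * m (-j) - m (-j) * w (i - 1)
      = (1 - qq ^ 2) • (w (i - 1) * m (-j)) := by
    have h : m (-j) * w (i - 1) = qq ^ 2 • (w (i - 1) * m (-j)) := by
      rw [h2, smul_smul, zpow_neg, zpow_ofNat, mul_inv_cancel₀ (pow_ne_zero 2 hq), one_smul]
    rw [h, sub_smul, one_smul]
  have hPQ : ((-i, j - 1) : ℤ × ℤ) ≠ (i - 1, -j) := by
    intro h
    have := congrArg Prod.fst h
    simp only at this
    omega
  rw [Finset.sum_mul_sum, Finset.sum_mul_sum,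
    Finset.sum_comm (s := Finset.Icc (-j) (j - 1)), ← Finset.sum_product',
    ← Finset.sum_product', ← Finset.sum_sub_distrib,
    ← Finset.sum_subset (s₁ := {(-i, j - 1), (i - 1, -j)}), Finset.sum_pair hPQ, hP, hQ]
  · have e : (qq - qq⁻¹) * qq = qq ^ 2 - 1 := by field_simp
    rw [← smul_neg, ← smul_neg, ← smul_sub, smul_smul, e, neg_sub_neg, smul_sub,
      ← neg_sub (qq ^ 2) 1, neg_smul, ← sub_eq_add_neg]
  · intro p hp
    simp only [Finset.mem_insert, Finset.mem_singleton] at hp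
    rcases hp with rfl | rfl <;> simp only [Finset.mem_product, Finset.mem_Icc] <;> omega
  · rintro ⟨r, s⟩ hmem hne
    simp only [Finset.mem_product, Finset.mem_Icc] at hmem
    simp only [Finset.mem_insert, Finset.mem_singleton, not_or] at hne
    exact sub_eq_zero.mpr
      (h3 r s hmem.1.1 hmem.1.2 hmem.2.1 hmem.2.2 hne.1 hne.2)

end
end

section
/- Let A be an associative 𝕂-algebra and i ≥ 1 an integer. Let u^t (−i ≤ t ≤ i−1) and v^r (−i−1 ≤ r ≤ i) be elements of A satisfying: u^t u^s = q^{−2} u^s u^t for t < s; v^r v^s = q^{−2} v^s v^r for r < s; and v^r u^t = q^{−1} u^t v^r if t ⊲ r while v^r u^t = q u^t v^r if t ⊳ r, where t ⊲ r means (t ≤ r if r < 0, and t < r if r ≥ 0) and t ⊳ r is the negation of t ⊲ r. Set E = Σ_{t=−i}^{i−1} u^t and E' = Σ_{r=−i−1}^{i} v^r. Then the quantum Serre relations hold: E'²E + EE'² = (q + q^{−1}) E'EE' and E²E' + E'E² = (q + q^{−1}) EE'E. (This is the verification of the quantum Serre relations for the images E_i = Σ u^t, E_{i+1} = Σ v^r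 of adjacent Chevalley generators under the cluster embedding ι.) -/
noncomputable section

/-- The order relation `t ⊲ r`: `t ≤ r` if `r < 0`, and `t < r` if `r ≥ 0`. -/
def lhd (t r : ℤ) : Prop := if r < 0 then t ≤ r else t < r

instance (t r : ℤ) : Decidable (lhd t r) := by unfold lhd; infer_instance

/-- The quantum Serre relation for `x₁ + x₂` and `y`, where `x₁`, `y`, `x₂` pairwise
`q`-commute. -/
theorem serre_add_of_qCommute {K A : Type*} [Field K] [Ring A] [Algebra K A] {q : K} (hq : q ≠ 0)
    {x₁ x₂ y : A} (h₁ : x₁ * y = q • (y * x₁)) (h₂ : x₂ * y = q⁻¹ • (y * x₂))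
    (h₁₂ : x₁ * x₂ = (q ^ (-2 : ℤ)) • (x₂ * x₁)) :
    (x₁ + x₂) * (x₁ + x₂) * y + y * ((x₁ + x₂) * (x₁ + x₂))
      = (q + q⁻¹) • ((x₁ + x₂) * y * (x₁ + x₂)) := by
  have hy : (x₁ + x₂) * y = y * (q • x₁ + q⁻¹ • x₂) := by
    rw [add_mul, h₁, h₂, mul_add, mul_smul_comm, mul_smul_comm]
  have hy' : (x₁ + x₂) * (x₁ + x₂) * y
      = y * ((q • x₁ + q⁻¹ • x₂) * (q • x₁ + q⁻¹ • x₂)) := by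
    have hs : (x₁ + x₂) * (y * (q • x₁ + q⁻¹ • x₂))
        = y * ((q • x₁ + q⁻¹ • x₂) * (q • x₁ + q⁻¹ • x₂)) := by
      rw [← mul_assoc, hy, mul_assoc]
    rw [mul_assoc, hy, hs]
  rw [hy', hy, mul_assoc, ← mul_add, ← mul_smul_comm]
  congr 1
  simp only [add_mul, mul_add, smul_mul_assoc, mul_smul_comm, smul_add, smul_smul, h₁₂]
  match_scalars
  all_goals field_simp
  all_goals ring

/-- The quantum Serre relation for `∑ a ∈ s, x a` and `∑ b ∈ t, y b`, where `P b` cuts `s`, for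
each `b ∈ t`, into the indices before `b` (where `P b` holds) and those after `b`. -/
theorem serre_sum_of_qCommute {K A ι κ : Type*} [Field K] [Ring A] [Algebra K A] {q : K}
    (hq : q ≠ 0) (s : Finset ι) (t : Finset κ) (x : ι → A) (y : κ → A) (P : κ → ι → Prop)
    (hx : ∀ b ∈ t, ∀ a ∈ s, ∀ a' ∈ s, P b a → ¬ P b a' →
      x a * x a' = (q ^ (-2 : ℤ)) • (x a' * x a))
    (h₁ : ∀ b ∈ t, ∀ a ∈ s, P b a → x a * y b = q • (y b * x a))
    (h₂ : ∀ b ∈ t, ∀ a ∈ s, ¬ P b a → x a * y b = q⁻¹ • (y b * x a)) :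
    (∑ a ∈ s, x a) * (∑ a ∈ s, x a) * (∑ b ∈ t, y b)
        + (∑ b ∈ t, y b) * ((∑ a ∈ s, x a) * (∑ a ∈ s, x a))
      = (q + q⁻¹) • ((∑ a ∈ s, x a) * (∑ b ∈ t, y b) * (∑ a ∈ s, x a)) := by
  classical
  rw [Finset.mul_sum t, Finset.sum_mul t, ← Finset.sum_add_distrib, Finset.mul_sum t,
    Finset.sum_mul t, Finset.smul_sum]
  refine Finset.sum_congr rfl fun b hb => ?_
  rw [← Finset.sum_filter_add_sum_filter_not s (P b) x]
  apply serre_add_of_qCommute hq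
  · rw [Finset.sum_mul, Finset.mul_sum, Finset.smul_sum]
    refine Finset.sum_congr rfl fun a ha => ?_
    rw [Finset.mem_filter] at ha
    exact h₁ b hb a ha.1 ha.2
  · rw [Finset.sum_mul, Finset.mul_sum, Finset.smul_sum]
    refine Finset.sum_congr rfl fun a ha => ?_
    rw [Finset.mem_filter] at ha
    exact h₂ b hb a ha.1 ha.2
  · rw [Finset.sum_mul_sum, Finset.sum_mul_sum, Finset.sum_comm, Finset.smul_sum]
    refine Finset.sum_congr rfl fun a' ha' => ?_
    rw [Finset.smul_sum]
    refine Finset.sum_congr rfl fun a ha => ?_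
    rw [Finset.mem_filter] at ha ha'
    exact hx b hb a ha.1 a' ha'.1 ha.2 ha'.2

theorem qq_ne_zero : qq ≠ 0 := RatFunc.X_ne_zero

theorem lt_of_not_lhd_of_lhd {t r r' : ℤ} (h : ¬ lhd t r) (h' : lhd t r') : r < r' := by
  unfold lhd at h h'
  split_ifs at h h' <;> omega

theorem lt_of_lhd_of_not_lhd {t t' r : ℤ} (h : lhd t r) (h' : ¬ lhd t' r) : t < t' := by
  unfold lhd at h h'
  split_ifs at h h' <;> omega

/-- Let `A` be an associative `𝕂`-algebra, `i ≥ 1`, and let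
`u^t` (`−i ≤ t ≤ i−1`) and `v^r` (`−i−1 ≤ r ≤ i`) be elements of `A` satisfying
`u^t u^s = q^{−2} u^s u^t` for `t < s`, `v^r v^s = q^{−2} v^s v^r` for `r < s`, and
`v^r u^t = q^{−1} u^t v^r` if `t ⊲ r` while `v^r u^t = q u^t v^r` if `t ⊳ r`.
Then, with `E = Σ_{t=−i}^{i−1} u^t` and `E' = Σ_{r=−i−1}^{i} v^r`, the quantum Serre
relations hold: `E'²E + EE'² = (q + q^{−1}) E'EE'` and `E²E' + E'E² = (q + q^{−1}) EE'E`. -/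
theorem statement6 {A : Type*} [Ring A] [Algebra Kq A] (i : ℤ) (hi : 1 ≤ i)
    (u v : ℤ → A)
    (huu : ∀ t s : ℤ, -i ≤ t → t < s → s ≤ i - 1 →
      u t * u s = (qq ^ (-2 : ℤ)) • (u s * u t))
    (hvv : ∀ r s : ℤ, -i - 1 ≤ r → r < s → s ≤ i →
      v r * v s = (qq ^ (-2 : ℤ)) • (v s * v r))
    (hvu1 : ∀ t r : ℤ, -i ≤ t → t ≤ i - 1 → -i - 1 ≤ r → r ≤ i → lhd t r →
      v r * u t = qq⁻¹ • (u t * v r))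
    (hvu2 : ∀ t r : ℤ, -i ≤ t → t ≤ i - 1 → -i - 1 ≤ r → r ≤ i → ¬ lhd t r →
      v r * u t = qq • (u t * v r)) :
    ((∑ r ∈ Finset.Icc (-i - 1) i, v r) * (∑ r ∈ Finset.Icc (-i - 1) i, v r)
          * (∑ t ∈ Finset.Icc (-i) (i - 1), u t)
        + (∑ t ∈ Finset.Icc (-i) (i - 1), u t)
          * ((∑ r ∈ Finset.Icc (-i - 1) i, v r) * (∑ r ∈ Finset.Icc (-i - 1) i, v r))
      = (qq + qq⁻¹) • ((∑ r ∈ Finset.Icc (-i - 1) i, v r)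
          * (∑ t ∈ Finset.Icc (-i) (i - 1), u t) * (∑ r ∈ Finset.Icc (-i - 1) i, v r)))
    ∧ ((∑ t ∈ Finset.Icc (-i) (i - 1), u t) * (∑ t ∈ Finset.Icc (-i) (i - 1), u t)
          * (∑ r ∈ Finset.Icc (-i - 1) i, v r)
        + (∑ r ∈ Finset.Icc (-i - 1) i, v r)
          * ((∑ t ∈ Finset.Icc (-i) (i - 1), u t) * (∑ t ∈ Finset.Icc (-i) (i - 1), u t))
      = (qq + qq⁻¹) • ((∑ t ∈ Finset.Icc (-i) (i - 1), u t)
          * (∑ r ∈ Finset.Icc (-i - 1) i, v r) * (∑ t ∈ Finset.Icc (-i) (i - 1), u t))) := by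
  constructor
  · refine serre_sum_of_qCommute qq_ne_zero _ _ v u (fun t r => ¬ lhd t r) ?_ ?_ ?_ <;>
      simp only [Finset.mem_Icc, not_not]
    · intro t _ r hr r' hr' h h'
      exact hvv r r' hr.1 (lt_of_not_lhd_of_lhd h h') hr'.2
    · intro t ht r hr h
      exact hvu2 t r ht.1 ht.2 hr.1 hr.2 h
    · intro t ht r hr h
      exact hvu1 t r ht.1 ht.2 hr.1 hr.2 h
  · refine serre_sum_of_qCommute qq_ne_zero _ _ u v (fun r t => lhd t r) ?_ ?_ ?_ <;>
      simp only [Finset.mem_Icc]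
    · intro r _ t ht t' ht' h h'
      exact huu t t' ht.1 (lt_of_lhd_of_not_lhd h h') ht'.2
    · intro r hr t ht h
      rw [hvu1 t r ht.1 ht.2 hr.1 hr.2 h, smul_smul, mul_inv_cancel₀ qq_ne_zero, one_smul]
    · intro r hr t ht h
      rw [hvu2 t r ht.1 ht.2 hr.1 hr.2 h, smul_smul, inv_mul_cancel₀ qq_ne_zero, one_smul]

end
end

section
/- The assignment E ↦ 𝐢(w_1 + w_2), F ↦ 𝐢(w_3 + w_4), K ↦ q w_2 w_3, K' ↦ q w_4 w_1 (with K^{−1}, (K')^{−1} sent to the inverses of the images of K, K') extends to an injective homomorphism of 𝕂-algebras 𝔇 → 𝒟. (This is Faddeev's embedding of the Drinfeld double of the Borel subalgebra of U_q(sl_2) into a quantum torus, recovered as the rank-one case of the cluster embedding.) -/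
noncomputable section

/-- `𝐢 = √−1 ∈ ℂ`, viewed as a constant in `𝕂 = ℂ(q)`. -/
def ii : Kq := RatFunc.C Complex.I

/-- Generators of the Drinfeld double `𝔇 = 𝔇₁` of the Borel subalgebra of `U_q(sl₂)`. -/
inductive FGen : Type
  | E | F | K | K' | Kinv | K'inv

/-- Shorthand for the generators inside the free algebra. -/
def fg (g : FGen) : FreeAlgebra Kq FGen := FreeAlgebra.ι Kq g

/-- The defining relations of `𝔇`: `KE = q²EK`, `K'E = q^{−2}EK'`, `KF = q^{−2}FK`,
`K'F = q²FK'`, `KK' = K'K`, `[E,F] = (q−q^{−1})(K−K')`, and invertibility of `K, K'`. -/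
inductive FRel : FreeAlgebra Kq FGen → FreeAlgebra Kq FGen → Prop
  | KE : FRel (fg .K * fg .E) ((qq ^ (2 : ℤ)) • (fg .E * fg .K))
  | K'E : FRel (fg .K' * fg .E) ((qq ^ (-2 : ℤ)) • (fg .E * fg .K'))
  | KF : FRel (fg .K * fg .F) ((qq ^ (-2 : ℤ)) • (fg .F * fg .K))
  | K'F : FRel (fg .K' * fg .F) ((qq ^ (2 : ℤ)) • (fg .F * fg .K'))
  | KK' : FRel (fg .K * fg .K') (fg .K' * fg .K)
  | EF : FRel (fg .E * fg .F) (fg .F * fg .E + (qq - qq⁻¹) • (fg .K - fg .K'))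
  | K_Kinv : FRel (fg .K * fg .Kinv) 1
  | Kinv_K : FRel (fg .Kinv * fg .K) 1
  | K'_K'inv : FRel (fg .K' * fg .K'inv) 1
  | K'inv_K' : FRel (fg .K'inv * fg .K') 1

/-- The Drinfeld double `𝔇` of the Borel subalgebra of `U_q(sl₂)`. -/
abbrev DD1 := RingQuot FRel

/-- The generators of `𝔇`. -/
def dd1 (g : FGen) : DD1 := RingQuot.mkAlgHom Kq FRel (fg g)

/-- The defining relations of the quantum torus `𝒟`: generators `w_i^{±1}` (`i ∈ ℤ/4`,
`Sum.inl i` is `w_{i+1}`, `Sum.inr i` is `w_{i+1}⁻¹`) with `w_i w_{i+1} = q^{−2} w_{i+1} w_i`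
(indices modulo 4) and `w_i w_{i+2} = w_{i+2} w_i`. -/
inductive WRel : FreeAlgebra Kq (Fin 4 ⊕ Fin 4) → FreeAlgebra Kq (Fin 4 ⊕ Fin 4) → Prop
  | cyc (i : Fin 4) :
      WRel (FreeAlgebra.ι Kq (Sum.inl i) * FreeAlgebra.ι Kq (Sum.inl (i + 1)))
        ((qq ^ (-2 : ℤ)) • (FreeAlgebra.ι Kq (Sum.inl (i + 1)) * FreeAlgebra.ι Kq (Sum.inl i)))
  | opp (i : Fin 4) :
      WRel (FreeAlgebra.ι Kq (Sum.inl i) * FreeAlgebra.ι Kq (Sum.inl (i + 2)))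
        (FreeAlgebra.ι Kq (Sum.inl (i + 2)) * FreeAlgebra.ι Kq (Sum.inl i))
  | mul_inv (i : Fin 4) :
      WRel (FreeAlgebra.ι Kq (Sum.inl i) * FreeAlgebra.ι Kq (Sum.inr i)) 1
  | inv_mul (i : Fin 4) :
      WRel (FreeAlgebra.ι Kq (Sum.inr i) * FreeAlgebra.ι Kq (Sum.inl i)) 1

/-- The quantum torus `𝒟` with generators `w₁^{±1}, …, w₄^{±1}`. -/
abbrev Wtorus := RingQuot WRel

/-- The generator `w_{i+1}` of `𝒟` (so `wg 0 = w₁`, …, `wg 3 = w₄`). -/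
def wg (i : Fin 4) : Wtorus := RingQuot.mkAlgHom Kq WRel (FreeAlgebra.ι Kq (Sum.inl i))

/-- `x` and `y` commute up to the scalar `r`: `x * y = r • (y * x)`. -/
def QCommute {k A : Type*} [Field k] [Ring A] [Algebra k A] (r : k) (x y : A) : Prop :=
  x * y = r • (y * x)

namespace QCommute

variable {k A : Type*} [Field k] [Ring A] [Algebra k A] {r s : k} {x y z : A}

theorem of_commute (h : x * y = y * x) : QCommute (1 : k) x y := by
  rw [QCommute, one_smul, h]

theorem symm (hr : r ≠ 0) (h : QCommute r x y) : QCommute r⁻¹ y x := by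
  rw [QCommute] at *
  rw [h, smul_smul, inv_mul_cancel₀ hr, one_smul]

theorem mul_left (hx : QCommute r x z) (hy : QCommute s y z) : QCommute (r * s) (x * y) z := by
  rw [QCommute] at *
  rw [mul_assoc, hy, mul_smul_comm, ← mul_assoc, hx, smul_mul_assoc, smul_smul, mul_assoc,
    mul_comm s]

theorem mul_right (hx : QCommute r z x) (hy : QCommute s z y) : QCommute (r * s) z (x * y) := by
  rw [QCommute] at *
  rw [← mul_assoc, hx, smul_mul_assoc, mul_assoc, hy, mul_smul_comm, smul_smul, mul_assoc]

theorem add_right (hx : QCommute r z x) (hy : QCommute r z y) : QCommute r z (x + y) := by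
  rw [QCommute] at *
  rw [mul_add, add_mul, hx, hy, smul_add]

theorem smul_left (c : k) (h : QCommute r x y) : QCommute r (c • x) y := by
  rw [QCommute] at *
  rw [smul_mul_assoc, h, mul_smul_comm, smul_comm]

theorem smul_right (c : k) (h : QCommute r x y) : QCommute r x (c • y) := by
  rw [QCommute] at *
  rw [smul_mul_assoc, mul_smul_comm, h, smul_comm]

theorem pow_right (h : QCommute r x y) (n : ℕ) : QCommute (r ^ n) x (y ^ n) := by
  induction n with
  | zero => simp [QCommute]
  | succ n ih => simpa only [pow_succ] using ih.mul_right h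

theorem units_inv_left {u : Aˣ} (hr : r ≠ 0) (h : QCommute r (u : A) y) :
    QCommute r⁻¹ (↑u⁻¹ : A) y := by
  rw [QCommute] at *
  have h' : y * u = r⁻¹ • (u * y) := by rw [h, smul_smul, inv_mul_cancel₀ hr, one_smul]
  calc (↑u⁻¹ : A) * y = ↑u⁻¹ * (y * u) * ↑u⁻¹ := by simp [mul_assoc]
    _ = r⁻¹ • (y * ↑u⁻¹) := by rw [h']; simp

end QCommute

theorem ii_mul_ii : ii * ii = -1 := by
  rw [ii, ← map_mul, Complex.I_mul_I, map_neg, map_one]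

theorem ii_ne_zero : ii ≠ 0 := by
  intro h
  simpa [h] using ii_mul_ii

/-! ### The homomorphism -/

/-- The inverse of the generator `wg i`. -/
def wgInv (i : Fin 4) : Wtorus := RingQuot.mkAlgHom Kq WRel (FreeAlgebra.ι Kq (Sum.inr i))

theorem wg_mul_wgInv (i : Fin 4) : wg i * wgInv i = 1 := by
  simpa only [wg, wgInv, map_mul, map_one] using RingQuot.mkAlgHom_rel Kq (WRel.mul_inv i)

theorem wgInv_mul_wg (i : Fin 4) : wgInv i * wg i = 1 := by
  simpa only [wg, wgInv, map_mul, map_one] using RingQuot.mkAlgHom_rel Kq (WRel.inv_mul i)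

theorem wg_cyc (i : Fin 4) : QCommute (qq ^ (-2 : ℤ)) (wg i) (wg (i + 1)) := by
  simpa only [QCommute, wg, map_mul, map_smul] using RingQuot.mkAlgHom_rel Kq (WRel.cyc i)

theorem wg_cyc_symm (i : Fin 4) : QCommute (qq ^ (2 : ℤ)) (wg (i + 1)) (wg i) := by
  simpa [zpow_neg] using (wg_cyc i).symm (zpow_ne_zero _ qq_ne_zero)

theorem wg_opp (i : Fin 4) : QCommute (1 : Kq) (wg i) (wg (i + 2)) := by
  refine .of_commute ?_
  simpa only [wg, map_mul] using RingQuot.mkAlgHom_rel Kq (WRel.opp i)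

theorem wg_self (i : Fin 4) : QCommute (1 : Kq) (wg i) (wg i) := .of_commute rfl

/-- Images of the generators of `𝔇` under Faddeev's embedding. -/
def faddeevGen : FGen → Wtorus
  | .E => ii • (wg 0 + wg 1)
  | .F => ii • (wg 2 + wg 3)
  | .K => qq • (wg 1 * wg 2)
  | .K' => qq • (wg 3 * wg 0)
  | .Kinv => qq⁻¹ • (wgInv 2 * wgInv 1)
  | .K'inv => qq⁻¹ • (wgInv 0 * wgInv 3)

theorem smul_wg_mul_inv (i j : Fin 4) :
    (qq • (wg i * wg j)) * (qq⁻¹ • (wgInv j * wgInv i)) = 1 := by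
  rw [smul_mul_smul_comm, mul_inv_cancel₀ qq_ne_zero, one_smul, mul_assoc,
    ← mul_assoc (wg j), wg_mul_wgInv, one_mul, wg_mul_wgInv]

theorem inv_mul_smul_wg (i j : Fin 4) :
    (qq⁻¹ • (wgInv j * wgInv i)) * (qq • (wg i * wg j)) = 1 := by
  rw [smul_mul_smul_comm, inv_mul_cancel₀ qq_ne_zero, one_smul, mul_assoc,
    ← mul_assoc (wgInv i), wgInv_mul_wg, one_mul, wgInv_mul_wg]

theorem qcommute_wg_mul_left {r s t : Kq} {i j l : Fin 4} (hi : QCommute r (wg i) (wg l))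
    (hj : QCommute s (wg j) (wg l)) (ht : r * s = t) : QCommute t (wg i * wg j) (wg l) :=
  ht ▸ hi.mul_left hj

theorem qcommute_faddeevGen_K_E :
    QCommute (qq ^ (2 : ℤ)) (faddeevGen .K) (faddeevGen .E) :=
  .smul_left _ <| .smul_right _ <| .add_right
    (qcommute_wg_mul_left (wg_cyc_symm 0) (wg_opp 2) (mul_one _))
    (qcommute_wg_mul_left (wg_self 1) (wg_cyc_symm 1) (one_mul _))

theorem qcommute_faddeevGen_K'_E :
    QCommute (qq ^ (-2 : ℤ)) (faddeevGen .K') (faddeevGen .E) :=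
  .smul_left _ <| .smul_right _ <| .add_right
    (qcommute_wg_mul_left (wg_cyc 3) (wg_self 0) (mul_one _))
    (qcommute_wg_mul_left (wg_opp 3) (wg_cyc 0) (one_mul _))

theorem qcommute_faddeevGen_K_F :
    QCommute (qq ^ (-2 : ℤ)) (faddeevGen .K) (faddeevGen .F) :=
  .smul_left _ <| .smul_right _ <| .add_right
    (qcommute_wg_mul_left (wg_cyc 1) (wg_self 2) (mul_one _))
    (qcommute_wg_mul_left (wg_opp 1) (wg_cyc 2) (one_mul _))

theorem qcommute_faddeevGen_K'_F :
    QCommute (qq ^ (2 : ℤ)) (faddeevGen .K') (faddeevGen .F) :=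
  .smul_left _ <| .smul_right _ <| .add_right
    (qcommute_wg_mul_left (wg_cyc_symm 2) (wg_opp 0) (mul_one _))
    (qcommute_wg_mul_left (wg_self 3) (wg_cyc_symm 3) (one_mul _))

theorem faddeevGen_K_mul_K' :
    faddeevGen .K * faddeevGen .K' = faddeevGen .K' * faddeevGen .K := by
  have h3 : QCommute (qq ^ (-2 : ℤ)) (wg 1 * wg 2) (wg 3) :=
    qcommute_wg_mul_left (wg_opp 1) (wg_cyc 2) (one_mul _)
  have h0 : QCommute (qq ^ (2 : ℤ)) (wg 1 * wg 2) (wg 0) :=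
    qcommute_wg_mul_left (wg_cyc_symm 0) (wg_opp 2) (mul_one _)
  have h := ((h3.mul_right h0).smul_right qq).smul_left qq
  rwa [← zpow_add₀ qq_ne_zero, neg_add_cancel, zpow_zero, QCommute, one_smul] at h

theorem smul_add_mul_smul_add {k A : Type*} [Field k] [Ring A] [Algebra k A] {q i : k}
    {a b c d : A} (hq : q ≠ 0) (hi : i * i = -1) (hac : QCommute (1 : k) a c)
    (hbd : QCommute (1 : k) b d) (had : QCommute (q ^ (2 : ℤ)) a d)
    (hcb : QCommute (q ^ (2 : ℤ)) c b) :
    (i • (a + b)) * (i • (c + d)) =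
      (i • (c + d)) * (i • (a + b)) + (q - q⁻¹) • (q • (b * c) - q • (d * a)) := by
  have hq2 : (q - q⁻¹) * q = q ^ (2 : ℤ) - 1 := by
    rw [sub_mul, inv_mul_cancel₀ hq, zpow_ofNat, sq]
  rw [QCommute] at hac hbd had hcb
  simp only [smul_mul_smul_comm, hi, ← smul_sub, smul_smul, hq2, mul_add, add_mul, hac, hbd,
    had, hcb]
  module

theorem faddeevGen_E_mul_F :
    faddeevGen .E * faddeevGen .F =
      faddeevGen .F * faddeevGen .E + (qq - qq⁻¹) • (faddeevGen .K - faddeevGen .K') :=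
  smul_add_mul_smul_add qq_ne_zero ii_mul_ii (wg_opp 0) (wg_opp 1) (wg_cyc_symm 3)
    (wg_cyc_symm 1)

theorem lift_faddeevGen_rel ⦃x y : FreeAlgebra Kq FGen⦄ (h : FRel x y) :
    FreeAlgebra.lift Kq faddeevGen x = FreeAlgebra.lift Kq faddeevGen y := by
  cases h <;>
    simp only [fg, map_mul, map_smul, map_add, map_sub, map_one, FreeAlgebra.lift_ι_apply]
  · exact qcommute_faddeevGen_K_E
  · exact qcommute_faddeevGen_K'_E
  · exact qcommute_faddeevGen_K_F
  · exact qcommute_faddeevGen_K'_F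
  · exact faddeevGen_K_mul_K'
  · exact faddeevGen_E_mul_F
  · exact smul_wg_mul_inv 1 2
  · exact inv_mul_smul_wg 1 2
  · exact smul_wg_mul_inv 3 0
  · exact inv_mul_smul_wg 3 0

/-- Faddeev's homomorphism `𝔇 → 𝒟`. -/
def faddeev : DD1 →ₐ[Kq] Wtorus :=
  RingQuot.liftAlgHom Kq ⟨FreeAlgebra.lift Kq faddeevGen, lift_faddeevGen_rel⟩

theorem faddeev_dd1 (g : FGen) : faddeev (dd1 g) = faddeevGen g := by
  simp [faddeev, dd1, fg]

/-! ### The quantum torus acting on functions on `ℤ⁴` -/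

/-- The operator `v ↦ (n ↦ q ^ (b ⬝ᵥ n) * v (n - e))`. -/
def shiftOp (b e : Fin 4 → ℤ) : Module.End Kq ((Fin 4 → ℤ) → Kq) where
  toFun v n := qq ^ (b ⬝ᵥ n) * v (n - e)
  map_add' u v := by ext n; simp [mul_add]
  map_smul' c v := by ext n; simp [mul_left_comm]

theorem shiftOp_apply (b e : Fin 4 → ℤ) (v : (Fin 4 → ℤ) → Kq) (n : Fin 4 → ℤ) :
    shiftOp b e v n = qq ^ (b ⬝ᵥ n) * v (n - e) := rfl

theorem shiftOp_mul (b e b' e' : Fin 4 → ℤ) :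
    shiftOp b e * shiftOp b' e' = (qq ^ (-(b' ⬝ᵥ e))) • shiftOp (b + b') (e + e') := by
  ext v n
  simp only [Module.End.mul_apply, LinearMap.smul_apply, Pi.smul_apply, smul_eq_mul,
    shiftOp_apply, ← mul_assoc, ← zpow_add₀ qq_ne_zero, dotProduct_sub, add_dotProduct,
    sub_sub]
  congr 2
  ring

theorem shiftOp_zero : shiftOp 0 0 = 1 := by
  ext v n
  simp [shiftOp_apply]

theorem shiftOp_qcommute (b e b' e' : Fin 4 → ℤ) :
    QCommute (qq ^ (b ⬝ᵥ e' - b' ⬝ᵥ e)) (shiftOp b e) (shiftOp b' e') := by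
  rw [QCommute, shiftOp_mul, shiftOp_mul, smul_smul, ← zpow_add₀ qq_ne_zero, add_comm b,
    add_comm e]
  congr 2
  ring

/-- The exponents in the action of the generators of the quantum torus. -/
def torusWeight : Fin 4 → Fin 4 → ℤ :=
  ![![0, 0, 0, 0], ![2, 0, 0, 0], ![0, 2, 0, 0], ![-2, 0, 2, 0]]

/-- The action of the generators of the quantum torus on functions on `ℤ⁴`. -/
def torusOp : Fin 4 ⊕ Fin 4 → Module.End Kq ((Fin 4 → ℤ) → Kq)
  | .inl i => shiftOp (torusWeight i) (Pi.single i 1)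
  | .inr i => shiftOp (-torusWeight i) (-Pi.single i 1)

theorem torusOp_qcommute (i j : Fin 4) (c : ℤ) (h : torusWeight i j - torusWeight j i = c) :
    QCommute (qq ^ c) (torusOp (.inl i)) (torusOp (.inl j)) := by
  subst h
  simpa [torusOp] using
    shiftOp_qcommute (torusWeight i) (Pi.single i 1) (torusWeight j) (Pi.single j 1)

theorem torusWeight_self (i : Fin 4) : torusWeight i i = 0 := by
  revert i; decide

theorem lift_torusOp_rel ⦃x y : FreeAlgebra Kq (Fin 4 ⊕ Fin 4)⦄ (h : WRel x y) :
    FreeAlgebra.lift Kq torusOp x = FreeAlgebra.lift Kq torusOp y := by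
  cases h <;> simp only [map_mul, map_smul, map_one, FreeAlgebra.lift_ι_apply]
  case cyc i =>
    exact torusOp_qcommute i (i + 1) _ (by revert i; decide)
  case opp i =>
    simpa [QCommute] using torusOp_qcommute i (i + 2) 0 (by revert i; decide)
  case mul_inv i => simp [torusOp, shiftOp_mul, torusWeight_self, shiftOp_zero]
  case inv_mul i => simp [torusOp, shiftOp_mul, torusWeight_self, shiftOp_zero]

/-- The representation of the quantum torus on functions on `ℤ⁴`. -/
def torusRep : Wtorus →ₐ[Kq] Module.End Kq ((Fin 4 → ℤ) → Kq) :=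
  RingQuot.liftAlgHom Kq ⟨FreeAlgebra.lift Kq torusOp, lift_torusOp_rel⟩

theorem torusRep_wg (i : Fin 4) : torusRep (wg i) = torusOp (.inl i) := by
  simp [torusRep, wg]

theorem torusRep_wgInv (i : Fin 4) : torusRep (wgInv i) = torusOp (.inr i) := by
  simp [torusRep, wgInv]

/-! ### Leading terms -/

/-- `n` is the unique point of the support of `v` at which `n 1 + n 3` is least. -/
def IsLeading (v : (Fin 4 → ℤ) → Kq) (n : Fin 4 → ℤ) : Prop :=
  v n ≠ 0 ∧ ∀ m, v m ≠ 0 → m ≠ n → n 1 + n 3 < m 1 + m 3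

namespace IsLeading

variable {v u : (Fin 4 → ℤ) → Kq} {n l : Fin 4 → ℤ}

theorem single : IsLeading (Pi.single n 1) n :=
  ⟨by simp, fun m hm hmn => absurd (by simp [hmn]) hm⟩

theorem smul {c : Kq} (hc : c ≠ 0) (h : IsLeading v n) : IsLeading (c • v) n :=
  ⟨mul_ne_zero hc h.1, fun m hm => h.2 m (right_ne_zero_of_mul hm)⟩

theorem shiftOp (h : IsLeading v n) (b e : Fin 4 → ℤ) :
    IsLeading (shiftOp b e v) (n + e) := by
  refine ⟨?_, fun m hm hmn => ?_⟩
  · rw [shiftOp_apply, add_sub_cancel_right]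
    exact mul_ne_zero (zpow_ne_zero _ qq_ne_zero) h.1
  · have := h.2 (m - e) (right_ne_zero_of_mul hm) fun h' => hmn (by rw [← h', sub_add_cancel])
    simp only [Pi.sub_apply, Pi.add_apply] at *
    linarith

theorem le (h : IsLeading v n) {m : Fin 4 → ℤ} (hm : v m ≠ 0) : n 1 + n 3 ≤ m 1 + m 3 := by
  rcases eq_or_ne m n with rfl | hmn
  · exact le_rfl
  · exact (h.2 m hm hmn).le

theorem add (hv : IsLeading v n) (hu : IsLeading u l) (h : n 1 + n 3 < l 1 + l 3) :
    IsLeading (v + u) n := by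
  refine ⟨?_, fun m hm hmn => ?_⟩
  · have : u n = 0 := by
      by_contra hn
      exact absurd (hu.le hn) (not_le.2 h)
    simpa [this] using hv.1
  · by_cases hvm : v m = 0
    · have hum : u m ≠ 0 := by simpa [hvm] using hm
      exact h.trans_le (hu.le hum)
    · exact hv.2 m hvm hmn

end IsLeading

theorem linearIndependent_of_isLeading {ι : Type*} {v : ι → (Fin 4 → ℤ) → Kq}
    {p : ι → Fin 4 → ℤ} (hp : Function.Injective p) (h : ∀ s, IsLeading (v s) (p s)) :
    LinearIndependent Kq v := by
  rw [linearIndependent_iff]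
  intro c hc
  by_contra hne
  obtain ⟨s, hs, hmin⟩ := c.support.exists_min_image (fun s => p s 1 + p s 3)
    (Finsupp.support_nonempty_iff.2 hne)
  have h0 : c s * v s (p s) = 0 := by
    have := congrFun hc (p s)
    rw [Finsupp.linearCombination_apply, Finsupp.sum, Finset.sum_apply,
      Finset.sum_eq_single s] at this
    · simpa using this
    · intro t ht hts
      have : v t (p s) = 0 := by
        by_contra hv
        exact absurd ((h t).2 _ hv (hp.ne hts.symm)) (not_lt.2 (hmin t ht))
      simp [this]
    · exact fun hs' => absurd hs hs'
  exact (mul_ne_zero (Finsupp.mem_support_iff.1 hs) (h s).1) h0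

/-! ### The action of `𝔇` on functions on `ℤ⁴` -/

/-- The representation of `𝔇` obtained by composing with Faddeev's homomorphism. -/
def doubleRep : DD1 →ₐ[Kq] Module.End Kq ((Fin 4 → ℤ) → Kq) := torusRep.comp faddeev

theorem doubleRep_dd1 (g : FGen) : doubleRep (dd1 g) = torusRep (faddeevGen g) := by
  simp [doubleRep, faddeev_dd1]

section Leading

variable {v : (Fin 4 → ℤ) → Kq} {n : Fin 4 → ℤ}

theorem IsLeading.doubleRep_E (h : IsLeading v n) :
    IsLeading (doubleRep (dd1 .E) v) (n + Pi.single 0 1) := by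
  simp only [doubleRep_dd1, faddeevGen, map_smul, map_add, torusRep_wg, LinearMap.smul_apply,
    LinearMap.add_apply]
  exact .smul ii_ne_zero ((h.shiftOp _ _).add (h.shiftOp _ _) (by simp))

theorem IsLeading.doubleRep_F (h : IsLeading v n) :
    IsLeading (doubleRep (dd1 .F) v) (n + Pi.single 2 1) := by
  simp only [doubleRep_dd1, faddeevGen, map_smul, map_add, torusRep_wg, LinearMap.smul_apply,
    LinearMap.add_apply]
  exact .smul ii_ne_zero ((h.shiftOp _ _).add (h.shiftOp _ _) (by simp))

theorem IsLeading.doubleRep_K (h : IsLeading v n) :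
    IsLeading (doubleRep (dd1 .K) v) (n + Pi.single 2 1 + Pi.single 1 1) := by
  simp only [doubleRep_dd1, faddeevGen, map_smul, map_mul, torusRep_wg, LinearMap.smul_apply,
    Module.End.mul_apply]
  exact .smul qq_ne_zero ((h.shiftOp _ _).shiftOp _ _)

theorem IsLeading.doubleRep_K' (h : IsLeading v n) :
    IsLeading (doubleRep (dd1 .K') v) (n + Pi.single 0 1 + Pi.single 3 1) := by
  simp only [doubleRep_dd1, faddeevGen, map_smul, map_mul, torusRep_wg, LinearMap.smul_apply,
    Module.End.mul_apply]
  exact .smul qq_ne_zero ((h.shiftOp _ _).shiftOp _ _)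

theorem IsLeading.doubleRep_Kinv (h : IsLeading v n) :
    IsLeading (doubleRep (dd1 .Kinv) v) (n + -Pi.single 1 1 + -Pi.single 2 1) := by
  simp only [doubleRep_dd1, faddeevGen, map_smul, map_mul, torusRep_wgInv, LinearMap.smul_apply,
    Module.End.mul_apply]
  exact .smul (inv_ne_zero qq_ne_zero) ((h.shiftOp _ _).shiftOp _ _)

theorem IsLeading.doubleRep_K'inv (h : IsLeading v n) :
    IsLeading (doubleRep (dd1 .K'inv) v) (n + -Pi.single 3 1 + -Pi.single 0 1) := by
  simp only [doubleRep_dd1, faddeevGen, map_smul, map_mul, torusRep_wgInv, LinearMap.smul_apply,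
    Module.End.mul_apply]
  exact .smul (inv_ne_zero qq_ne_zero) ((h.shiftOp _ _).shiftOp _ _)

end Leading

theorem IsLeading.doubleRep_pow {x : DD1} {e : Fin 4 → ℤ}
    (hx : ∀ v n, IsLeading v n → IsLeading (doubleRep x v) (n + e))
    {v : (Fin 4 → ℤ) → Kq} {n : Fin 4 → ℤ} (h : IsLeading v n) (a : ℕ) :
    IsLeading (doubleRep (x ^ a) v) (n + (a : ℤ) • e) := by
  induction a with
  | zero => simpa using h
  | succ a ih =>
    rw [pow_succ', map_mul, Module.End.mul_apply]
    convert hx _ _ ih using 1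
    push_cast
    module

theorem IsLeading.doubleRep_zpow {u : DD1ˣ} {e : Fin 4 → ℤ}
    (hu : ∀ v n, IsLeading v n → IsLeading (doubleRep (u : DD1) v) (n + e))
    (hinv : ∀ v n, IsLeading v n → IsLeading (doubleRep (↑u⁻¹ : DD1) v) (n - e))
    {v : (Fin 4 → ℤ) → Kq} {n : Fin 4 → ℤ} (h : IsLeading v n) (c : ℤ) :
    IsLeading (doubleRep (↑(u ^ c) : DD1) v) (n + c • e) := by
  obtain ⟨a, rfl | rfl⟩ := c.eq_nat_or_neg
  · simpa using h.doubleRep_pow hu a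
  · simpa [← inv_zpow] using h.doubleRep_pow (e := -e) (by simpa [sub_eq_add_neg] using hinv) a

/-! ### Spanning by ordered monomials -/

theorem dd1_K_E : QCommute (qq ^ (2 : ℤ)) (dd1 .K) (dd1 .E) := by
  simpa only [QCommute, dd1, map_mul, map_smul] using RingQuot.mkAlgHom_rel Kq FRel.KE

theorem dd1_K'_E : QCommute (qq ^ (-2 : ℤ)) (dd1 .K') (dd1 .E) := by
  simpa only [QCommute, dd1, map_mul, map_smul] using RingQuot.mkAlgHom_rel Kq FRel.K'E

theorem dd1_K_F : QCommute (qq ^ (-2 : ℤ)) (dd1 .K) (dd1 .F) := by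
  simpa only [QCommute, dd1, map_mul, map_smul] using RingQuot.mkAlgHom_rel Kq FRel.KF

theorem dd1_K'_F : QCommute (qq ^ (2 : ℤ)) (dd1 .K') (dd1 .F) := by
  simpa only [QCommute, dd1, map_mul, map_smul] using RingQuot.mkAlgHom_rel Kq FRel.K'F

theorem dd1_E_mul_F :
    dd1 .E * dd1 .F = dd1 .F * dd1 .E + (qq - qq⁻¹) • (dd1 .K - dd1 .K') := by
  simpa only [dd1, map_mul, map_smul, map_add, map_sub] using RingQuot.mkAlgHom_rel Kq FRel.EF

/-- The generator `K` of `𝔇` as a unit. -/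
def unitK : DD1ˣ where
  val := dd1 .K
  inv := dd1 .Kinv
  val_inv := by simpa only [dd1, map_mul, map_one] using RingQuot.mkAlgHom_rel Kq FRel.K_Kinv
  inv_val := by simpa only [dd1, map_mul, map_one] using RingQuot.mkAlgHom_rel Kq FRel.Kinv_K

/-- The generator `K'` of `𝔇` as a unit. -/
def unitK' : DD1ˣ where
  val := dd1 .K'
  inv := dd1 .K'inv
  val_inv := by simpa only [dd1, map_mul, map_one] using RingQuot.mkAlgHom_rel Kq FRel.K'_K'inv
  inv_val := by simpa only [dd1, map_mul, map_one] using RingQuot.mkAlgHom_rel Kq FRel.K'inv_K'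

theorem commute_unitK_unitK' : Commute unitK unitK' :=
  Units.ext (by
    simpa only [Units.val_mul, unitK, unitK', dd1, map_mul] using
      RingQuot.mkAlgHom_rel Kq FRel.KK')

/-- The monomial `E ^ a * F ^ b * (K ^ c * K' ^ d)` of `𝔇`. -/
def pbwMonomial (s : ℕ × ℕ × ℤ × ℤ) : DD1 :=
  dd1 .E ^ s.1 * dd1 .F ^ s.2.1 * (↑(unitK ^ s.2.2.1 * unitK' ^ s.2.2.2) : DD1)

/-- The linear span of the monomials `pbwMonomial`. -/
def pbwSpan : Submodule Kq DD1 := Submodule.span Kq (Set.range pbwMonomial)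

theorem pbwMonomial_mem (s : ℕ × ℕ × ℤ × ℤ) : pbwMonomial s ∈ pbwSpan :=
  Submodule.subset_span ⟨s, rfl⟩

theorem mul_mem_pbwSpan {x : DD1} (hx : ∀ s, x * pbwMonomial s ∈ pbwSpan) {y : DD1}
    (hy : y ∈ pbwSpan) : x * y ∈ pbwSpan := by
  induction hy using Submodule.span_induction with
  | mem y h => obtain ⟨s, rfl⟩ := h; exact hx s
  | zero => simp
  | add y z _ _ ihy ihz => rw [mul_add]; exact add_mem ihy ihz
  | smul c y _ ih => rw [mul_smul_comm]; exact Submodule.smul_mem _ _ ih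

theorem E_mul_mem_pbwSpan {y : DD1} (hy : y ∈ pbwSpan) : dd1 .E * y ∈ pbwSpan := by
  refine mul_mem_pbwSpan (fun s => ?_) hy
  convert pbwMonomial_mem (s.1 + 1, s.2) using 1
  simp only [pbwMonomial, pow_succ', mul_assoc]

theorem unit_mul_mem_pbwSpan {u : DD1ˣ} {r t : Kq} (hE : QCommute r (u : DD1) (dd1 .E))
    (hF : QCommute t (u : DD1) (dd1 .F))
    (hu : ∀ c d : ℤ, ∃ c' d' : ℤ, u * (unitK ^ c * unitK' ^ d) = unitK ^ c' * unitK' ^ d')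
    {y : DD1} (hy : y ∈ pbwSpan) : (u : DD1) * y ∈ pbwSpan := by
  refine mul_mem_pbwSpan (fun s => ?_) hy
  obtain ⟨c', d', h⟩ := hu s.2.2.1 s.2.2.2
  have hEF := (hE.pow_right s.1).mul_right (hF.pow_right s.2.1)
  rw [QCommute] at hEF
  rw [pbwMonomial, ← mul_assoc, hEF, smul_mul_assoc, mul_assoc, ← Units.val_mul, h]
  exact Submodule.smul_mem _ _ (pbwMonomial_mem (s.1, s.2.1, c', d'))

theorem unitK_zpow_mul (k c d : ℤ) :
    unitK ^ k * (unitK ^ c * unitK' ^ d) = unitK ^ (k + c) * unitK' ^ d := by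
  rw [← mul_assoc, ← zpow_add]

theorem unitK'_zpow_mul (k c d : ℤ) :
    unitK' ^ k * (unitK ^ c * unitK' ^ d) = unitK ^ c * unitK' ^ (k + d) := by
  rw [← mul_assoc, ← (commute_unitK_unitK'.zpow_zpow c k).eq, mul_assoc, ← zpow_add]

theorem K_mul_mem_pbwSpan {y : DD1} (hy : y ∈ pbwSpan) : dd1 .K * y ∈ pbwSpan :=
  unit_mul_mem_pbwSpan (u := unitK) dd1_K_E dd1_K_F
    (fun c d => ⟨1 + c, d, by simpa using unitK_zpow_mul 1 c d⟩) hy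

theorem K'_mul_mem_pbwSpan {y : DD1} (hy : y ∈ pbwSpan) : dd1 .K' * y ∈ pbwSpan :=
  unit_mul_mem_pbwSpan (u := unitK') dd1_K'_E dd1_K'_F
    (fun c d => ⟨c, 1 + d, by simpa using unitK'_zpow_mul 1 c d⟩) hy

theorem Kinv_mul_mem_pbwSpan {y : DD1} (hy : y ∈ pbwSpan) : dd1 .Kinv * y ∈ pbwSpan :=
  unit_mul_mem_pbwSpan (u := unitK⁻¹)
    (.units_inv_left (u := unitK) (zpow_ne_zero _ qq_ne_zero) dd1_K_E)
    (.units_inv_left (u := unitK) (zpow_ne_zero _ qq_ne_zero) dd1_K_F)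
    (fun c d => ⟨-1 + c, d, by simpa using unitK_zpow_mul (-1) c d⟩) hy

theorem K'inv_mul_mem_pbwSpan {y : DD1} (hy : y ∈ pbwSpan) : dd1 .K'inv * y ∈ pbwSpan :=
  unit_mul_mem_pbwSpan (u := unitK'⁻¹)
    (.units_inv_left (u := unitK') (zpow_ne_zero _ qq_ne_zero) dd1_K'_E)
    (.units_inv_left (u := unitK') (zpow_ne_zero _ qq_ne_zero) dd1_K'_F)
    (fun c d => ⟨c, -1 + d, by simpa using unitK'_zpow_mul (-1) c d⟩) hy

theorem F_mul_mem_pbwSpan {y : DD1} (hy : y ∈ pbwSpan) : dd1 .F * y ∈ pbwSpan := by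
  refine mul_mem_pbwSpan (fun ⟨a, b, c, d⟩ => ?_) hy
  induction a with
  | zero =>
    convert pbwMonomial_mem (0, b + 1, c, d) using 1
    simp only [pbwMonomial, pow_succ', mul_assoc, pow_zero, one_mul]
  | succ a ih =>
    have hs : pbwMonomial (a + 1, b, c, d) = dd1 .E * pbwMonomial (a, b, c, d) := by
      simp only [pbwMonomial, pow_succ', mul_assoc]
    rw [hs, ← mul_assoc, eq_sub_of_add_eq dd1_E_mul_F.symm, sub_mul, smul_mul_assoc, sub_mul,
      mul_assoc]
    exact sub_mem (E_mul_mem_pbwSpan ih) <| Submodule.smul_mem _ _ <|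
      sub_mem (K_mul_mem_pbwSpan (pbwMonomial_mem _)) (K'_mul_mem_pbwSpan (pbwMonomial_mem _))

theorem dd1_mul_mem_pbwSpan (g : FGen) {y : DD1} (hy : y ∈ pbwSpan) :
    dd1 g * y ∈ pbwSpan := by
  cases g
  · exact E_mul_mem_pbwSpan hy
  · exact F_mul_mem_pbwSpan hy
  · exact K_mul_mem_pbwSpan hy
  · exact K'_mul_mem_pbwSpan hy
  · exact Kinv_mul_mem_pbwSpan hy
  · exact K'inv_mul_mem_pbwSpan hy

theorem pbwSpan_eq_top : pbwSpan = ⊤ := by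
  have hmul (x : FreeAlgebra Kq FGen) :
      ∀ y ∈ pbwSpan, RingQuot.mkAlgHom Kq FRel x * y ∈ pbwSpan := by
    induction x using FreeAlgebra.induction with
    | grade0 r =>
      intro y hy
      rw [AlgHom.commutes, ← Algebra.smul_def]
      exact Submodule.smul_mem _ _ hy
    | grade1 g => exact fun y hy => dd1_mul_mem_pbwSpan g hy
    | mul a b ha hb =>
      intro y hy
      rw [map_mul, mul_assoc]
      exact ha _ (hb _ hy)
    | add a b ha hb =>
      intro y hy
      rw [map_add, add_mul]
      exact add_mem (ha _ hy) (hb _ hy)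
  refine eq_top_iff.2 fun x _ => ?_
  obtain ⟨x, rfl⟩ := RingQuot.mkAlgHom_surjective Kq FRel x
  have h1 : (1 : DD1) ∈ pbwSpan := by simpa [pbwMonomial] using pbwMonomial_mem (0, 0, 0, 0)
  simpa using hmul x 1 h1

/-! ### Injectivity -/

/-- The exponent of the leading term of `pbwMonomial s`. -/
def leadingExponent (s : ℕ × ℕ × ℤ × ℤ) : Fin 4 → ℤ :=
  ![s.1 + s.2.2.2, s.2.2.1, s.2.1 + s.2.2.1, s.2.2.2]

theorem leadingExponent_injective : Function.Injective leadingExponent := by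
  rintro ⟨a, b, c, d⟩ ⟨a', b', c', d'⟩ h
  have h0 := congrFun h 0
  have h1 := congrFun h 1
  have h2 := congrFun h 2
  have h3 := congrFun h 3
  simp [leadingExponent] at h0 h1 h2 h3
  simp only [Prod.mk.injEq]
  omega

theorem isLeading_pbwMonomial (s : ℕ × ℕ × ℤ × ℤ) :
    IsLeading (doubleRep (pbwMonomial s) (Pi.single 0 1)) (leadingExponent s) := by
  have hK' := (IsLeading.single (n := 0)).doubleRep_zpow (u := unitK')
    (e := Pi.single 0 1 + Pi.single 3 1)
    (fun v n h => by rw [← add_assoc]; exact h.doubleRep_K')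
    (fun v n h => by rw [sub_eq_add_neg, neg_add_rev, ← add_assoc]; exact h.doubleRep_K'inv) s.2.2.2
  have hK := hK'.doubleRep_zpow (u := unitK) (e := Pi.single 2 1 + Pi.single 1 1)
    (fun v n h => by rw [← add_assoc]; exact h.doubleRep_K)
    (fun v n h => by rw [sub_eq_add_neg, neg_add_rev, ← add_assoc]; exact h.doubleRep_Kinv) s.2.2.1
  have hF := hK.doubleRep_pow (fun v n h => h.doubleRep_F) s.2.1
  have hE := hF.doubleRep_pow (fun v n h => h.doubleRep_E) s.1
  convert hE using 1
  · simp only [pbwMonomial, Units.val_mul, map_mul, Module.End.mul_apply]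
  · ext i
    fin_cases i <;> simp [leadingExponent, add_comm]

theorem faddeev_injective : Function.Injective faddeev := by
  have hli : LinearIndependent Kq
      fun s => doubleRep (pbwMonomial s) (Pi.single (0 : Fin 4 → ℤ) 1) :=
    linearIndependent_of_isLeading leadingExponent_injective isLeading_pbwMonomial
  rw [injective_iff_map_eq_zero]
  intro x hx
  obtain ⟨c, rfl⟩ := (Finsupp.mem_span_range_iff_exists_finsupp).1
    (pbwSpan_eq_top ▸ Submodule.mem_top : x ∈ pbwSpan)
  have h0 : doubleRep (c.sum fun s r => r • pbwMonomial s) (Pi.single 0 1) = 0 := by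
    rw [doubleRep, AlgHom.comp_apply, hx, map_zero, LinearMap.zero_apply]
  have hc : c = 0 := by
    refine linearIndependent_iff.1 hli c ?_
    rw [← h0]
    simp [Finsupp.linearCombination_apply, Finsupp.sum, map_sum, LinearMap.sum_apply]
  simp [hc]

/-- Faddeev's embedding: the assignment `E ↦ 𝐢(w₁ + w₂)`,
`F ↦ 𝐢(w₃ + w₄)`, `K ↦ q w₂ w₃`, `K' ↦ q w₄ w₁` (with `K^{−1}`, `(K')^{−1}` sent to the
inverses of the images of `K`, `K'`) extends to an injective homomorphism of
`𝕂`-algebras `𝔇 → 𝒟`. -/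
theorem statement16 :
    ∃ f : DD1 →ₐ[Kq] Wtorus,
      Function.Injective f ∧
      f (dd1 .E) = ii • (wg 0 + wg 1) ∧
      f (dd1 .F) = ii • (wg 2 + wg 3) ∧
      f (dd1 .K) = qq • (wg 1 * wg 2) ∧
      f (dd1 .K') = qq • (wg 3 * wg 0) ∧
      f (dd1 .Kinv) * f (dd1 .K) = 1 ∧ f (dd1 .K) * f (dd1 .Kinv) = 1 ∧
      f (dd1 .K'inv) * f (dd1 .K') = 1 ∧ f (dd1 .K') * f (dd1 .K'inv) = 1 := by
  refine ⟨faddeev, faddeev_injective, ?_⟩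
  simp only [faddeev_dd1]
  exact ⟨rfl, rfl, rfl, rfl, inv_mul_smul_wg 1 2, smul_wg_mul_inv 1 2, inv_mul_smul_wg 3 0,
    smul_wg_mul_inv 3 0⟩

end
end
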